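/- Let N > 1 be an integer and k > 1/2 real. Then the double series over zeros can be exchanged with the integral and (1/(8πi))·∫_{(1/N)} e^{Nz}·z^{−k−2}·(∑_{ρ₁} z^{−ρ₁/2}Γ(ρ₁/2))·(∑_{ρ₂} z^{−ρ₂/2}Γ(ρ₂/2)) dz = (N^{k+1}/4)·∑_{ρ₁}∑_{ρ₂} N^{ρ₁/2+ρ₂/2}·Γ(ρ₁/2)Γ(ρ₂/2)/Γ(k+2+ρ₁/2+ρ₂/2), where ρ₁, ρ₂ run over the non-trivial zeros of the Riemann zeta function and ∫_{(1/N)} denotes the integral over the vertical line Re(z) = 1/N. -/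

import Mathlib

open Complex

noncomputable section

/-- The non-trivial zeros of the Riemann zeta function. -/
def zetaZeros : Set ℂ := {ρ | riemannZeta ρ = 0 ∧ 0 < ρ.re ∧ ρ.re < 1}

open MeasureTheory Set Filter Topology in
/-- The Laplace transform of a power function. -/
theorem integral_cpow_mul_exp_neg_mul_Ioi_of_re_pos {a r : ℂ} (ha : 0 < a.re) (hr : 0 < r.re) :
    ∫ t : ℝ in Ioi 0, (t : ℂ) ^ (a - 1) * cexp (-(r * t)) = r ^ (-a) * Complex.Gamma a := by
  have hopen : IsOpen {z : ℂ | 0 < z.re} := isOpen_lt continuous_const Complex.continuous_re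
  have hint (s : ℝ) (hs : 0 < s) (c : ℝ) (hc : 0 < c) :
      IntegrableOn (fun t : ℝ ↦ t ^ (s - 1) * Real.exp (-c * t)) (Ioi 0) := by
    simpa using integrableOn_rpow_mul_exp_neg_mul_rpow (p := 1) (s := s - 1) (b := c)
      (by linarith) one_pos hc
  have hmeas (b z : ℂ) : AEStronglyMeasurable
      (fun t : ℝ ↦ (t : ℂ) ^ b * cexp (-(z * t))) (volume.restrict (Ioi 0)) := by
    refine ContinuousOn.aestronglyMeasurable ?_ measurableSet_Ioi
    refine ContinuousOn.mul (fun t ht ↦ ?_) (by fun_prop)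
    exact (Complex.continuousAt_ofReal_cpow_const t b (Or.inr (ne_of_gt ht))).continuousWithinAt
  have hnorm (b z : ℂ) {t : ℝ} (ht : 0 < t) :
      ‖(t : ℂ) ^ b * cexp (-(z * t))‖ = t ^ b.re * Real.exp (-z.re * t) := by
    rw [norm_mul, Complex.norm_cpow_eq_rpow_re_of_pos ht, Complex.norm_exp]
    simp
  have hdiff : DifferentiableOn ℂ
      (fun z : ℂ ↦ ∫ t : ℝ in Ioi 0, (t : ℂ) ^ (a - 1) * cexp (-(z * t))) {z | 0 < z.re} := by
    intro z hz
    have hz : 0 < z.re := hz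
    refine DifferentiableAt.differentiableWithinAt ?_
    have hs : {w : ℂ | z.re / 2 < w.re} ∈ 𝓝 z :=
      (isOpen_lt continuous_const Complex.continuous_re).mem_nhds
        (show z.re / 2 < z.re by linarith)
    refine (hasDerivAt_integral_of_dominated_loc_of_deriv_le hs
      (Eventually.of_forall fun w ↦ hmeas (a - 1) w) ?_
      (F' := fun w (t : ℝ) ↦ -((t : ℂ) ^ a * cexp (-(w * t)))) (hmeas a z).neg
      (bound := fun t : ℝ ↦ t ^ (a.re + 1 - 1) * Real.exp (-(z.re / 2) * t)) ?_
      (hint _ (by linarith) _ (by linarith)) ?_).2.differentiableAt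
    · refine (hint a.re ha z.re hz).mono' (hmeas _ _) ?_
      filter_upwards [ae_restrict_mem measurableSet_Ioi] with t ht
      rw [hnorm _ _ ht]; simp
    · filter_upwards [ae_restrict_mem measurableSet_Ioi] with t ht w hw
      have ht : 0 < t := ht
      have hw : z.re / 2 < w.re := hw
      rw [norm_neg, hnorm _ _ ht, add_sub_cancel_right]
      gcongr
    · filter_upwards [ae_restrict_mem measurableSet_Ioi] with t ht w hw
      have ht : (t : ℂ) ≠ 0 := ofReal_ne_zero.2 (ne_of_gt ht)
      have h : HasDerivAt (fun w : ℂ ↦ -(w * t)) (-(1 * t)) w := ((hasDerivAt_id w).mul_const _).neg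
      convert! (h.cexp.const_mul ((t : ℂ) ^ (a - 1))) using 1
      rw [cpow_sub _ _ ht, cpow_one]
      field_simp
  have hdiff' : DifferentiableOn ℂ (fun z : ℂ ↦ z ^ (-a) * Complex.Gamma a) {z | 0 < z.re} :=
    fun z hz ↦ ((differentiableAt_id.cpow_const (Or.inl hz)).mul_const _).differentiableWithinAt
  refine (hdiff.analyticOnNhd hopen).eqOn_of_preconnected_of_frequently_eq
    (hdiff'.analyticOnNhd hopen) (convex_halfSpace_re_gt 0).isPreconnected (z₀ := 1)
    (by simp) ?_ hr
  have hlim : Tendsto (fun n : ℕ ↦ ((1 + 1 / ((n : ℝ) + 1) : ℝ) : ℂ)) atTop (𝓝[≠] 1) := by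
    refine tendsto_nhdsWithin_iff.2 ⟨?_, Eventually.of_forall fun n ↦ ?_⟩
    · have := (tendsto_one_div_add_atTop_nhds_zero_nat (𝕜 := ℝ)).const_add 1
      rw [add_zero] at this
      exact_mod_cast (Complex.continuous_ofReal.tendsto 1).comp this
    · have : (0 : ℝ) < 1 / ((n : ℝ) + 1) := by positivity
      rw [mem_compl_singleton_iff, ← ofReal_one, Ne, ofReal_inj]
      linarith
  refine hlim.frequently (Frequently.of_forall fun n ↦ ?_)
  have hpos : (0 : ℝ) < 1 + 1 / ((n : ℝ) + 1) := by positivity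
  have h := Complex.integral_cpow_mul_exp_neg_mul_Ioi ha hpos
  rw [h, one_div, inv_cpow _ _ (by rw [arg_ofReal_of_nonneg hpos.le]; exact Real.pi_pos.ne),
    cpow_neg]

open MeasureTheory in
theorem integrable_norm_vertical_rpow_neg {c p : ℝ} (hc : 0 < c) (hp : 1 < p) :
    Integrable (fun y : ℝ ↦ ‖(c : ℂ) + y * I‖ ^ (-p)) := by
  have hne (y : ℝ) : (c : ℂ) + y * I ≠ 0 := fun h ↦ hc.ne' (by simpa using congrArg re h)
  have hδ : 0 < min c 1 / 2 := by positivity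
  refine ((integrable_one_add_norm (E := ℝ) (μ := volume) (r := p)
    (by simpa using hp)).const_mul ((min c 1 / 2) ^ (-p))).mono'
    (Continuous.aestronglyMeasurable ?_) (ae_of_all _ fun y ↦ ?_)
  · exact Continuous.rpow_const (by fun_prop) fun y ↦ Or.inl (norm_ne_zero_iff.2 (hne y))
  · rw [Real.norm_of_nonneg (by positivity), ← Real.mul_rpow hδ.le (by positivity)]
    refine Real.rpow_le_rpow_of_nonpos (by positivity) ?_ (by linarith)
    have h1 : c ≤ ‖(c : ℂ) + y * I‖ := by
      simpa using re_le_norm ((c : ℂ) + y * I)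
    have h2 : |y| ≤ ‖(c : ℂ) + y * I‖ := by
      simpa using abs_im_le_norm ((c : ℂ) + y * I)
    rw [Real.norm_eq_abs]
    nlinarith [min_le_left c 1, min_le_right c 1, abs_nonneg y]

open MeasureTheory in
theorem integrable_exp_mul_vertical_cpow {c x : ℝ} {w : ℂ} (hc : 0 < c) (hw : 1 < w.re) :
    Integrable (fun y : ℝ ↦ cexp (x * (c + y * I)) * ((c : ℂ) + y * I) ^ (-w)) := by
  have hne (y : ℝ) : (c : ℂ) + y * I ≠ 0 := fun h ↦ hc.ne' (by simpa using congrArg re h)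
  refine ((integrable_norm_vertical_rpow_neg hc hw).const_mul
    (Real.exp (x * c) * Real.exp (Real.pi * |w.im|))).mono'
    (Continuous.aestronglyMeasurable ?_) (ae_of_all _ fun y ↦ ?_)
  · refine Continuous.mul (by fun_prop) (Continuous.cpow (by fun_prop) continuous_const fun y ↦ ?_)
    exact Or.inl (by simpa using hc)
  · rw [norm_mul, norm_cpow_of_ne_zero (hne y), norm_exp, mul_assoc]
    have : (↑x * (↑c + ↑y * I)).re = x * c := by simp
    rw [this, neg_re, div_eq_mul_inv, ← Real.exp_neg, mul_comm (Real.exp (Real.pi * _))]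
    gcongr
    rw [neg_im, mul_neg, neg_neg]
    refine (le_abs_self _).trans ?_
    rw [abs_mul]
    gcongr
    exact abs_arg_le_pi _

open MeasureTheory Set Filter Topology in
/-- Inversion of the Laplace transform of a power function. -/
theorem integral_exp_mul_vertical_cpow {c x : ℝ} {w : ℂ} (hc : 0 < c) (hx : 0 < x)
    (hw : 1 < w.re) :
    ∫ y : ℝ, cexp (x * (c + y * I)) * ((c : ℂ) + y * I) ^ (-w) =
      2 * Real.pi * (x : ℂ) ^ (w - 1) / Complex.Gamma w := by
  have hw0 : 0 < w.re := by linarith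
  set f : ℝ → ℂ := (Ioi 0).indicator fun t : ℝ ↦ (t : ℂ) ^ (w - 1) * cexp (-(c * t)) with hf
  have hfour (v : ℝ) : FourierTransform.fourier f v =
      ((c : ℂ) + (2 * Real.pi * v : ℝ) * I) ^ (-w) * Complex.Gamma w := by
    rw [Real.fourier_real_eq_integral_exp_smul,
      ← integral_cpow_mul_exp_neg_mul_Ioi_of_re_pos hw0 (by simpa using hc),
      ← integral_indicator measurableSet_Ioi]
    congr 1 with t
    by_cases ht : t ∈ Ioi (0 : ℝ)
    · rw [hf, indicator_of_mem ht, indicator_of_mem ht, smul_eq_mul, mul_left_comm,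
        ← Complex.exp_add]
      congr 2
      push_cast
      ring
    · rw [hf, indicator_of_notMem ht, indicator_of_notMem ht, smul_zero]
  have hfint : Integrable f := by
    rw [hf, integrable_indicator_iff measurableSet_Ioi]
    have h := integrableOn_rpow_mul_exp_neg_mul_rpow (p := 1) (s := w.re - 1) (b := c)
      (by linarith) one_pos hc
    refine Integrable.mono' h (ContinuousOn.aestronglyMeasurable ?_ measurableSet_Ioi) ?_
    · refine ContinuousOn.mul (fun t ht ↦ ?_) (by fun_prop)
      exact (continuousAt_ofReal_cpow_const t _ (Or.inr (ne_of_gt ht))).continuousWithinAt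
    · filter_upwards [ae_restrict_mem measurableSet_Ioi] with t ht
      rw [norm_mul, norm_cpow_eq_rpow_re_of_pos ht, norm_exp]
      simp
  have hbase := (integrable_exp_mul_vertical_cpow (x := 0) hc hw).comp_mul_left'
    (R := 2 * Real.pi) (by positivity)
  have hFint : Integrable (FourierTransform.fourier f) := by
    rw [show FourierTransform.fourier f = _ from funext hfour]
    refine Integrable.mul_const ?_ _
    simpa using hbase
  have hcont : ContinuousAt f x := by
    have heq : f =ᶠ[𝓝 x] fun t : ℝ ↦ (t : ℂ) ^ (w - 1) * cexp (-(c * t)) := by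
      filter_upwards [Ioi_mem_nhds hx] with t ht
      rw [hf, indicator_of_mem ht]
    refine ContinuousAt.congr ?_ heq.symm
    exact (continuousAt_ofReal_cpow_const x _ (Or.inr hx.ne')).mul (by fun_prop)
  have hinv := hfint.fourierInv_fourier_eq hFint hcont
  rw [Real.fourierInv_eq'] at hinv
  simp_rw [hfour] at hinv
  have hG : Complex.Gamma w ≠ 0 := Gamma_ne_zero_of_re_pos hw0
  have hscale := Measure.integral_comp_mul_left
    (fun y : ℝ ↦ cexp (x * (c + y * I)) * ((c : ℂ) + y * I) ^ (-w)) (2 * Real.pi)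
  have hsame : ∫ v : ℝ, cexp (↑(2 * Real.pi * inner ℝ v x) * I) •
      (((c : ℂ) + (2 * Real.pi * v : ℝ) * I) ^ (-w) * Complex.Gamma w) =
      (cexp (-(x * c)) * Complex.Gamma w) * ∫ v : ℝ, cexp (x * (c + (2 * Real.pi * v : ℝ) * I)) *
        ((c : ℂ) + (2 * Real.pi * v : ℝ) * I) ^ (-w) := by
    rw [← integral_const_mul]
    congr 1 with v
    have : cexp (↑(2 * Real.pi * inner ℝ v x) * I) =
        cexp (-(x * c)) * cexp (x * (c + (2 * Real.pi * v : ℝ) * I)) := by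
      rw [← Complex.exp_add]
      congr 1
      simp
      ring
    rw [smul_eq_mul, this]
    ring
  rw [hsame, hscale, hf, indicator_of_mem (show x ∈ Ioi (0 : ℝ) from hx), abs_inv,
    abs_of_pos (by positivity), real_smul] at hinv
  have he : cexp (-(x * c)) ≠ 0 := exp_ne_zero _
  rw [mul_comm (c : ℂ) x] at hinv
  have hpi : (Real.pi : ℂ) ≠ 0 := ofReal_ne_zero.2 Real.pi_ne_zero
  rw [eq_div_iff hG]
  push_cast at hinv
  field_simp at hinv
  linear_combination hinv

theorem im_mul_arg_eq_abs (z : ℂ) : z.im * z.arg = |z.im| * |z.arg| := by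
  rw [← abs_mul, abs_of_nonneg]
  rcases le_or_gt 0 z.im with h | h
  · exact mul_nonneg h (arg_nonneg_iff.2 h)
  · exact mul_nonneg_of_nonpos_of_nonpos h.le (arg_neg_iff.2 h).le

/-- The argument of a point of the right half plane stays away from `±π / 2`. -/
theorem re_div_norm_le_pi_div_two_sub_abs_arg {z : ℂ} (hz : 0 < z.re) :
    z.re / ‖z‖ ≤ Real.pi / 2 - |z.arg| := by
  have hz0 : z ≠ 0 := fun h ↦ by simp [h] at hz
  rw [← cos_arg hz0, ← Real.cos_abs, ← Real.sin_pi_div_two_sub]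
  exact Real.sin_le (sub_nonneg.2 (abs_arg_le_pi_div_two_iff.2 hz.le))

theorem abs_im_mul_pi_div_two_sub_abs_arg_le {z : ℂ} (hz : 0 < z.re) :
    |z.im| * (Real.pi / 2 - |z.arg|) ≤ z.re := by
  have hz0 : z ≠ 0 := fun h ↦ by simp [h] at hz
  have hn : 0 < ‖z‖ := norm_pos_iff.2 hz0
  rcases eq_or_ne z.im 0 with h0 | h0
  · simpa [h0] using hz.le
  have harg : z.arg ≠ 0 := fun h ↦ h0 ((arg_eq_zero_iff.1 h).2)
  have h1 : 0 ≤ Real.pi / 2 - |z.arg| := sub_nonneg.2 (abs_arg_le_pi_div_two_iff.2 hz.le)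
  have h2 : Real.pi / 2 - |z.arg| < Real.pi / 2 := by linarith [abs_pos.2 harg]
  have h3 := Real.le_tan h1 h2
  have hs : Real.sin |z.arg| = |z.im| / ‖z‖ := by
    rw [← Real.abs_sin_eq_sin_abs_of_abs_le_pi (abs_arg_le_pi z), sin_arg, abs_div, abs_norm]
  rw [Real.tan_pi_div_two_sub, Real.tan_eq_sin_div_cos, Real.cos_abs, cos_arg hz0, hs] at h3
  have h4 : 0 < |z.im| := abs_pos.2 h0
  calc |z.im| * (Real.pi / 2 - |z.arg|) ≤ |z.im| * (|z.im| / ‖z‖ / (z.re / ‖z‖))⁻¹ := by gcongr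
    _ = z.re := by field_simp

open MeasureTheory Set in
theorem norm_Gamma_le_Gamma_re {s : ℂ} (hs : 0 < s.re) :
    ‖Complex.Gamma s‖ ≤ Real.Gamma s.re := by
  rw [Complex.Gamma_eq_integral hs, Real.Gamma_eq_integral hs, Complex.GammaIntegral]
  refine (norm_integral_le_integral_norm _).trans (le_of_eq ?_)
  refine setIntegral_congr_fun measurableSet_Ioi fun t ht ↦ ?_
  rw [norm_mul, norm_cpow_eq_rpow_re_of_pos ht, norm_real, Real.norm_of_nonneg (Real.exp_pos _).le]
  simp

theorem norm_Gamma_sq_of_eq_conj {s : ℂ} (t : ℂ) (h : t = (starRingEnd ℂ) s) :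
    ‖Complex.Gamma s‖ ^ 2 = ‖Complex.Gamma s * Complex.Gamma t‖ := by
  rw [h, Gamma_conj, norm_mul, RCLike.norm_conj, sq]

theorem norm_Gamma_one_add_mul_I_le (t : ℝ) :
    ‖Complex.Gamma (t * I + 1)‖ ≤
      5 * ‖(t * I + 1 : ℂ)‖ ^ (1 / 2 : ℝ) * Real.exp (-(Real.pi / 2 * |t|)) := by
  rcases eq_or_ne t 0 with rfl | ht
  · simp
  have hu : 0 < |t| := abs_pos.2 ht
  set x := Real.pi * |t| with hx
  have hx0 : 0 < x := by positivity
  have hsq : ‖Complex.Gamma (t * I + 1)‖ ^ 2 = x / Real.sinh x := by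
    have hne : (t : ℂ) * I ≠ 0 := by simpa using ht
    rw [norm_Gamma_sq_of_eq_conj (1 - t * I) (by simp [sub_eq_add_neg, add_comm]),
      Complex.Gamma_add_one _ hne, mul_assoc, Complex.Gamma_mul_Gamma_one_sub, ← mul_assoc,
      Complex.sin_mul_I, ← ofReal_mul, ← ofReal_sinh, norm_mul, norm_div, norm_mul, norm_mul,
      norm_I, norm_real, norm_real, norm_real, Real.norm_eq_abs, Real.norm_eq_abs, Real.norm_eq_abs,
      Real.abs_sinh, abs_mul, abs_of_pos Real.pi_pos]
    rw [← hx, mul_one, mul_one, hx]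
    ring
  have hsinh : x / Real.sinh x ≤ 2 * (1 + x) * Real.exp (-x) := by
    rw [div_le_iff₀ (Real.sinh_pos_iff.2 hx0), Real.sinh_eq]
    have h1 : Real.exp (-x) * Real.exp x = 1 := by rw [← Real.exp_add]; simp
    have h2 : (1 + x) * Real.exp (-x) ≤ 1 := by
      rw [← h1, mul_comm]
      gcongr
      linarith [Real.add_one_le_exp x]
    have h3 : Real.exp (-x) ≤ 1 := Real.exp_le_one_iff.2 (by linarith)
    nlinarith [Real.exp_pos (-x)]
  have hn : 1 + |t| ≤ 2 * ‖(t * I + 1 : ℂ)‖ := by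
    have h1 := abs_re_le_norm (t * I + 1 : ℂ)
    have h2 := abs_im_le_norm (t * I + 1 : ℂ)
    simp at h1 h2
    linarith
  refine le_of_sq_le_sq ?_ (by positivity)
  rw [hsq, mul_pow, mul_pow, ← Real.rpow_natCast (_ ^ _), ← Real.rpow_mul (norm_nonneg _),
    ← Real.exp_nat_mul]
  have he : ((2 : ℕ) : ℝ) * -(Real.pi / 2 * |t|) = -x := by rw [hx]; push_cast; ring
  rw [he]
  refine hsinh.trans (mul_le_mul_of_nonneg_right ?_ (Real.exp_pos _).le)
  have hx4 : x ≤ 4 * |t| := by rw [hx]; gcongr; exact Real.pi_le_four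
  norm_num
  linarith

theorem norm_Gamma_three_half_add_mul_I_le (t : ℝ) :
    ‖Complex.Gamma ((1 / 2 + t * I) + 1)‖ ≤
      5 * ‖((1 / 2 + t * I) + 1 : ℂ)‖ * Real.exp (-(Real.pi / 2 * |t|)) := by
  set x := Real.pi * |t| with hx
  have hne : (1 / 2 + t * I : ℂ) ≠ 0 := fun h ↦ by simpa using congrArg re h
  have hsq : ‖Complex.Gamma (1 / 2 + t * I)‖ ^ 2 = Real.pi / Real.cosh x := by
    rw [norm_Gamma_sq_of_eq_conj (1 - (1 / 2 + t * I)) ?_, Complex.Gamma_mul_Gamma_one_sub]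
    · rw [mul_add, mul_one_div, Complex.sin_add, Complex.sin_pi_div_two, Complex.cos_pi_div_two,
        one_mul, zero_mul, add_zero, ← mul_assoc, Complex.cos_mul_I, ← ofReal_mul, ← ofReal_cosh,
        norm_div, norm_real, norm_real, Real.norm_of_nonneg Real.pi_pos.le,
        Real.norm_of_nonneg (Real.cosh_pos _).le, hx, ← Real.cosh_abs, abs_mul,
        abs_of_pos Real.pi_pos]
    · apply Complex.ext <;> norm_num
  have hcosh : Real.pi / Real.cosh x ≤ 2 * Real.pi * Real.exp (-x) := by
    rw [div_le_iff₀ (Real.cosh_pos _), Real.cosh_eq]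
    have h1 : Real.exp (-x) * Real.exp x = 1 := by rw [← Real.exp_add]; simp
    nlinarith [Real.exp_pos (-x), Real.pi_pos, mul_pos Real.pi_pos (Real.exp_pos (-x)),
      mul_pos (mul_pos Real.pi_pos (Real.exp_pos (-x))) (Real.exp_pos (-x))]
  rw [Complex.Gamma_add_one _ hne, norm_mul, mul_comm, mul_right_comm]
  have hle : ‖(1 / 2 + t * I : ℂ)‖ ≤ ‖((1 / 2 + t * I) + 1 : ℂ)‖ := by
    rw [Complex.norm_def, Complex.norm_def]
    refine Real.sqrt_le_sqrt ?_
    simp [normSq_apply]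
    norm_num
  refine mul_le_mul ?_ hle (norm_nonneg _) (by positivity)
  refine le_of_sq_le_sq ?_ (by positivity)
  rw [hsq, mul_pow, ← Real.exp_nat_mul]
  have he : ((2 : ℕ) : ℝ) * -(Real.pi / 2 * |t|) = -x := by rw [hx]; push_cast; ring
  rw [he]
  refine hcosh.trans ?_
  gcongr
  linarith [Real.pi_le_four]

open Set in
/-- A uniform bound of Stirling type for the Gamma function in a vertical strip. -/
theorem norm_Gamma_add_one_le {s : ℂ} (h0 : 0 ≤ s.re) (h1 : s.re ≤ 1 / 2) :
    ‖Complex.Gamma (s + 1)‖ ≤ 5 * Real.exp (3 / 2) *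
      ‖s + 1‖ ^ (s.re + 1 / 2) * Real.exp (-(Real.pi / 2 * |s.im|)) := by
  set g : ℂ → ℂ := fun s ↦ Complex.Gamma (s + 1) * (s + 1) ^ (-(s + 1 / 2)) with hg
  have hne (s : ℂ) (hs : 0 ≤ s.re) : s + 1 ≠ 0 := fun h ↦ by
    have := congrArg re h
    simp at this
    linarith
  have hgn (s : ℂ) (hs : 0 ≤ s.re) : ‖g s‖ = ‖Complex.Gamma (s + 1)‖ *
      ‖s + 1‖ ^ (-(s.re + 1 / 2)) * Real.exp (|s.im| * |(s + 1).arg|) := by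
    have him := im_mul_arg_eq_abs (s + 1)
    have hre : (-(s + 1 / 2)).re = -(s.re + 1 / 2) := by simp
    have him' : (s + 1).arg * (-(s + 1 / 2)).im = -(s.im * (s + 1).arg) := by simp; ring
    simp only [add_im, one_im, add_zero] at him
    rw [hg, norm_mul, norm_cpow_of_ne_zero (hne s hs), hre, him', him, Real.exp_neg, div_inv_eq_mul,
      mul_assoc]
  have hone (s : ℂ) (hs : 0 ≤ s.re) : 1 ≤ ‖s + 1‖ := by
    have := re_le_norm (s + 1)
    simp at this
    linarith
  have harg (s : ℂ) (hs : 0 ≤ s.re) :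
      Real.exp (|s.im| * |(s + 1).arg|) ≤ Real.exp (Real.pi / 2 * |s.im|) := by
    rw [mul_comm (Real.pi / 2)]
    gcongr
    exact abs_arg_le_pi_div_two_iff.2 (by simp; linarith)
  have hedge (s : ℂ) (hs : 0 ≤ s.re)
      (h : ‖Complex.Gamma (s + 1)‖ ≤
        5 * ‖s + 1‖ ^ (s.re + 1 / 2) * Real.exp (-(Real.pi / 2 * |s.im|))) : ‖g s‖ ≤ 5 := by
    have hp : 0 < ‖s + 1‖ := one_pos.trans_le (hone s hs)
    rw [hgn s hs]
    calc _ ≤ (5 * ‖s + 1‖ ^ (s.re + 1 / 2) * Real.exp (-(Real.pi / 2 * |s.im|))) *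
          ‖s + 1‖ ^ (-(s.re + 1 / 2)) * Real.exp (Real.pi / 2 * |s.im|) := by
          exact mul_le_mul (mul_le_mul_of_nonneg_right h (by positivity)) (harg s hs)
            (by positivity) (by positivity)
      _ = 5 := by
          rw [Real.rpow_neg hp.le, Real.exp_neg]
          field_simp
  have hd (s : ℂ) (hs : 0 ≤ s.re) : DifferentiableAt ℂ g s := by
    refine DifferentiableAt.mul ?_ (DifferentiableAt.cpow (by fun_prop) (by fun_prop) ?_)
    · refine DifferentiableAt.comp (g := Complex.Gamma) s (differentiableAt_Gamma _ fun m h ↦ ?_)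
        (by fun_prop)
      have := congrArg re h
      simp at this
      have : (0 : ℝ) ≤ m := by positivity
      linarith
    · left; simp; linarith
  have hbd : ‖g s‖ ≤ 5 := by
    refine PhragmenLindelof.vertical_strip (a := 0) (b := 1 / 2) (DifferentiableOn.diffContOnCl ?_)
      ⟨Real.pi, by rw [show Real.pi / (1 / 2 - 0) = 2 * Real.pi by ring]; linarith [Real.pi_pos],
        1, ?_⟩ (fun z hz ↦ hedge z hz.ge ?_)
      (fun z hz ↦ hedge z (by rw [hz]; norm_num) ?_) h0 h1
    · intro z hz
      refine (hd z ?_).differentiableWithinAt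
      have hsub : closure (re ⁻¹' Ioo (0 : ℝ) (1 / 2)) ⊆ re ⁻¹' Ici 0 :=
        closure_minimal (fun z hz ↦ hz.1.le) (isClosed_Ici.preimage continuous_re)
      exact hsub hz
    · refine Asymptotics.IsBigO.of_bound 1 ?_
      refine Filter.mem_inf_of_right (Filter.mem_principal.2 fun z hz ↦ ?_)
      have hz0 : 0 ≤ z.re := hz.1.le
      have hz1 : z.re < 1 / 2 := hz.2
      have hG : ‖Complex.Gamma (z + 1)‖ ≤ 1 := by
        refine (norm_Gamma_le_Gamma_re (by simp; linarith)).trans ?_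
        have := Real.convexOn_Gamma.2 (show (1 : ℝ) ∈ Ioi 0 by simp)
          (show (2 : ℝ) ∈ Ioi 0 by simp) (show 0 ≤ 1 - z.re by linarith) hz0 (by ring)
        simp only [Real.Gamma_one, Real.Gamma_two, smul_eq_mul] at this
        convert! this using 1
        · congr 1; simp; ring
        · ring
      have hR : ‖z + 1‖ ^ (-(z.re + 1 / 2)) ≤ 1 :=
        Real.rpow_le_one_of_one_le_of_nonpos (hone z hz0) (by linarith)
      change ‖g z‖ ≤ 1 * ‖Real.exp (1 * Real.exp (Real.pi * |z.im|))‖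
      rw [hgn z hz0, one_mul, one_mul, Real.norm_of_nonneg (Real.exp_pos _).le]
      calc _ ≤ 1 * 1 * Real.exp (Real.pi / 2 * |z.im|) := by
            exact mul_le_mul (mul_le_mul hG hR (by positivity) zero_le_one) (harg z hz0)
              (by positivity) (by positivity)
        _ ≤ _ := by
            rw [one_mul, one_mul, Real.exp_le_exp]
            have := Real.add_one_le_exp (Real.pi * |z.im|)
            have : 0 ≤ Real.pi * |z.im| := by positivity
            linarith
    · have hz' : z = z.im * I := by apply Complex.ext <;> simp [hz]
      have := norm_Gamma_one_add_mul_I_le z.im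
      rwa [← hz', show (1 / 2 : ℝ) = z.re + 1 / 2 by rw [hz]; ring] at this
    · have hz' : z = 1 / 2 + z.im * I := by apply Complex.ext <;> simp [hz]
      have := norm_Gamma_three_half_add_mul_I_le z.im
      rw [← hz'] at this
      rwa [hz, show (1 / 2 + 1 / 2 : ℝ) = 1 by norm_num, Real.rpow_one]
  rw [hgn s h0] at hbd
  have hp : 0 < ‖s + 1‖ := one_pos.trans_le (hone s h0)
  have hkey := abs_im_mul_pi_div_two_sub_abs_arg_le (z := s + 1) (by simp; linarith)
  simp only [add_im, one_im, add_zero, add_re, one_re] at hkey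
  have hexp : Real.exp (-(|s.im| * |(s + 1).arg|)) ≤
      Real.exp (3 / 2) * Real.exp (-(Real.pi / 2 * |s.im|)) := by
    rw [← Real.exp_add, Real.exp_le_exp]
    linarith
  calc ‖Complex.Gamma (s + 1)‖ = (‖Complex.Gamma (s + 1)‖ *
      ‖s + 1‖ ^ (-(s.re + 1 / 2)) * Real.exp (|s.im| * |(s + 1).arg|)) *
      ‖s + 1‖ ^ (s.re + 1 / 2) * Real.exp (-(|s.im| * |(s + 1).arg|)) := by
        rw [Real.rpow_neg hp.le, Real.exp_neg]
        field_simp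
    _ ≤ 5 * ‖s + 1‖ ^ (s.re + 1 / 2) *
        (Real.exp (3 / 2) * Real.exp (-(Real.pi / 2 * |s.im|))) := by gcongr
    _ = _ := by ring

/-- A family of reals `u ≥ 1` with at most `C * r ^ a` members up to `r` has `∑ u ^ (-b) < ∞` for
`b > a`. -/
theorem summable_rpow_neg_of_card_le {ι : Type*} {u : ι → ℝ} {C a b : ℝ} (hu : ∀ i, 1 ≤ u i)
    (ha : 0 ≤ a) (hab : a < b)
    (hcard : ∀ r : ℝ, 1 ≤ r → ∀ S : Finset ι, (∀ i ∈ S, u i ≤ r) → (S.card : ℝ) ≤ C * r ^ a) :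
    Summable fun i ↦ u i ^ (-b) := by
  have hC : 0 ≤ C := by simpa using hcard 1 le_rfl ∅ (by simp)
  have hgeom : Summable fun j : ℕ ↦ C * 2 ^ a * ((2 : ℝ) ^ (a - b)) ^ j :=
    (summable_geometric_of_lt_one (by positivity)
      (Real.rpow_lt_one_of_one_lt_of_neg one_lt_two (by linarith))).mul_left _
  have hfloor (i : ι) : ⌊u i⌋₊ ≠ 0 := (Nat.floor_pos.2 (hu i)).ne'
  refine summable_of_sum_le (c := ∑' j : ℕ, C * 2 ^ a * ((2 : ℝ) ^ (a - b)) ^ j)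
    (fun i ↦ Real.rpow_nonneg (zero_le_one.trans (hu i)) _) fun S ↦ ?_
  set l : ι → ℕ := fun i ↦ Nat.log 2 ⌊u i⌋₊ with hl
  have hlow (i : ι) : (2 : ℝ) ^ l i ≤ u i := by
    have h := Nat.pow_log_le_self 2 (hfloor i)
    exact (by exact_mod_cast h : (2 : ℝ) ^ l i ≤ ⌊u i⌋₊).trans
      (Nat.floor_le (zero_le_one.trans (hu i)))
  have hupp (i : ι) : u i ≤ (2 : ℝ) ^ (l i + 1) := by
    have h := Nat.lt_pow_succ_log_self one_lt_two ⌊u i⌋₊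
    refine (Nat.lt_floor_add_one (u i)).le.trans ?_
    exact_mod_cast h
  classical
  rw [← Finset.sum_fiberwise_of_maps_to (t := S.image l)
    (fun i hi ↦ Finset.mem_image_of_mem l hi)]
  refine le_trans (Finset.sum_le_sum fun j _ ↦ ?_)
    (hgeom.sum_le_tsum (S.image l) fun j _ ↦ by positivity)
  have hterm (i : ι) (hi : i ∈ S.filter (l · = j)) : u i ^ (-b) ≤ ((2 : ℝ) ^ j) ^ (-b) := by
    rw [← (Finset.mem_filter.1 hi).2]
    exact Real.rpow_le_rpow_of_nonpos (by positivity) (hlow i) (by linarith)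
  refine (Finset.sum_le_card_nsmul _ _ _ hterm).trans ?_
  rw [nsmul_eq_mul]
  have hc := hcard (2 ^ (j + 1)) (one_le_pow₀ one_le_two) (S.filter (l · = j)) fun i hi ↦ by
    rw [← (Finset.mem_filter.1 hi).2]
    exact hupp i
  refine (mul_le_mul_of_nonneg_right hc (by positivity)).trans (le_of_eq ?_)
  rw [pow_succ, Real.mul_rpow (by positivity) (by positivity), Real.rpow_sub two_pos,
    Real.rpow_neg (by positivity), ← Real.rpow_natCast, ← Real.rpow_natCast,
    ← Real.rpow_mul two_pos.le,
    ← Real.rpow_mul two_pos.le, Real.div_rpow (by positivity) (by positivity),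
    ← Real.rpow_mul two_pos.le, ← Real.rpow_mul two_pos.le, mul_comm a, mul_comm b]
  ring

/-- Jensen's bound for the number of zeros, counted without multiplicity. -/
theorem card_zeros_le_log {f : ℂ → ℂ} (hf : Differentiable ℂ f) (h0 : ‖f 0‖ = 1) {r M : ℝ}
    (hr : 0 < r) (hM : 1 ≤ M) (hb : ∀ z, ‖z‖ = Real.exp 1 * r → ‖f z‖ ≤ M) (S : Finset ℂ)
    (hS : ∀ z ∈ S, ‖z‖ ≤ r ∧ f z = 0) : (S.card : ℝ) ≤ Real.log M := by
  have hR : 0 < Real.exp 1 * r := by positivity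
  have han : AnalyticOnNhd ℂ f Set.univ := hf.differentiableOn.analyticOnNhd isOpen_univ
  have h0' : f 0 ≠ 0 := norm_ne_zero_iff.1 (by rw [h0]; exact one_ne_zero)
  have hJ := AnalyticOnNhd.sum_divisor_le (c := 0) (r := r) (R := Real.exp 1 * r) (M := M) (f := f)
    (by rwa [abs_of_pos hr])
    (by rw [abs_of_pos hr, abs_of_pos hR]; nlinarith [Real.add_one_lt_exp one_ne_zero])
    hM (han.mono (Set.subset_univ _)) h0'
    (fun z hz ↦ hb z (by rw [mem_sphere_zero_iff_norm, abs_of_pos hR] at hz; exact hz))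
  rw [h0, div_one, mul_div_assoc, div_self hr.ne', mul_one, Real.log_exp, div_one] at hJ
  refine le_trans ?_ hJ
  set D := MeromorphicOn.divisor f (Metric.closedBall 0 |r|) with hD
  have hmer : MeromorphicOn f (Metric.closedBall 0 |r|) :=
    (han.mono (Set.subset_univ _)).meromorphicOn
  have hnonneg : 0 ≤ D := MeromorphicOn.AnalyticOnNhd.divisor_nonneg (han.mono (Set.subset_univ _))
  have hone (z : ℂ) (hz : z ∈ S) : 1 ≤ D z := by
    have hz' : z ∈ Metric.closedBall (0 : ℂ) |r| := by
      simpa [abs_of_pos hr] using (hS z hz).1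
    rw [hD, MeromorphicOn.divisor_apply hmer hz', (han z trivial).meromorphicOrderAt_eq]
    have hne : analyticOrderAt f z ≠ 0 := (han z trivial).analyticOrderAt_ne_zero.2 (hS z hz).2
    have htop : analyticOrderAt f z ≠ ⊤ := by
      intro h
      have := han.eqOn_zero_of_preconnected_of_eventuallyEq_zero isPreconnected_univ
        (Set.mem_univ z) (analyticOrderAt_eq_top.1 h)
      exact h0' (this (Set.mem_univ 0))
    lift analyticOrderAt f z to ℕ using htop with n
    have : n ≠ 0 := by exact_mod_cast hne
    simp
    omega
  have hfin : D.support.Finite := D.finiteSupport (isCompact_closedBall _ _)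
  rw [finsum_eq_sum_of_support_subset (s := hfin.toFinset) _ (by simp)]
  have hsub : S ⊆ hfin.toFinset := fun z hz ↦ by
    have := hone z hz
    simp
    omega
  have h1 : (S.card : ℤ) ≤ ∑ z ∈ hfin.toFinset, D z := by
    calc (S.card : ℤ) = ∑ z ∈ S, 1 := by simp
      _ ≤ ∑ z ∈ S, D z := Finset.sum_le_sum hone
      _ ≤ _ := Finset.sum_le_sum_of_subset_of_nonneg hsub fun z _ _ ↦ hnonneg z
  exact_mod_cast h1

open MeasureTheory Set in
/-- A Mellin transform is bounded on closed vertical strips on whose edges it converges. -/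
theorem norm_mellin_le_of_re_mem_Icc {f : ℝ → ℂ} {a b : ℂ} (ha : MellinConvergent f a)
    (hb : MellinConvergent f b) :
    ∃ C : ℝ, ∀ s : ℂ, a.re ≤ s.re → s.re ≤ b.re → ‖mellin f s‖ ≤ C := by
  refine ⟨∫ t in Ioi (0 : ℝ), (‖(t : ℂ) ^ (a - 1) • f t‖ + ‖(t : ℂ) ^ (b - 1) • f t‖),
    fun s has hsb ↦ ?_⟩
  refine norm_integral_le_of_norm_le (ha.norm.add hb.norm) ?_
  filter_upwards [ae_restrict_mem measurableSet_Ioi] with t ht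
  have ht : 0 < t := ht
  simp only [norm_smul, norm_cpow_eq_rpow_re_of_pos ht, sub_re, one_re, ← add_mul]
  refine mul_le_mul_of_nonneg_right ?_ (norm_nonneg _)
  rcases le_total t 1 with h | h
  · exact (Real.rpow_le_rpow_of_exponent_ge ht h (by linarith)).trans
      (le_add_of_nonneg_right (by positivity))
  · exact (Real.rpow_le_rpow_of_exponent_le h (by linarith)).trans
      (le_add_of_nonneg_left (by positivity))

theorem norm_completedRiemannZeta₀_le_of_re_mem_Icc (a b : ℝ) :
    ∃ C : ℝ, ∀ s : ℂ, a ≤ s.re → s.re ≤ b → ‖completedRiemannZeta₀ s‖ ≤ C := by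
  have hP := (HurwitzZeta.hurwitzEvenFEPair 0).isStrongFEPair_toStrongFEPair
  obtain ⟨C, hC⟩ := norm_mellin_le_of_re_mem_Icc (hP.hasMellin (a / 2 : ℝ)).1
    (hP.hasMellin (b / 2 : ℝ)).1
  refine ⟨C / 2, fun s has hsb ↦ ?_⟩
  have hs : (s / 2).re = s.re / 2 := by simp
  rw [completedRiemannZeta₀, HurwitzZeta.completedHurwitzZetaEven₀, norm_div, norm_ofNat]
  gcongr
  refine hC (s / 2) ?_ ?_ <;> rw [hs, ofReal_re] <;> linarith

theorem Gamma_real_le_rpow {x : ℝ} (hx : 2 ≤ x) : Real.Gamma x ≤ (2 * x) ^ (2 * x) := by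
  have hc : x ≤ ⌈x⌉₊ := Nat.le_ceil x
  have hc' : (⌈x⌉₊ : ℝ) ≤ 2 * x := by
    linarith [Nat.ceil_lt_add_one (show 0 ≤ x by linarith)]
  calc Real.Gamma x ≤ Real.Gamma (⌈x⌉₊ + 1) :=
        Real.Gamma_strictMonoOn_Ici.monotoneOn hx
          (by simp only [Set.mem_Ici]; linarith) (by linarith)
    _ = (⌈x⌉₊.factorial : ℝ) := Real.Gamma_nat_eq_factorial _
    _ ≤ (⌈x⌉₊ : ℝ) ^ ⌈x⌉₊ := mod_cast Nat.factorial_le_pow _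
    _ ≤ (2 * x) ^ ⌈x⌉₊ := by gcongr
    _ = (2 * x) ^ (⌈x⌉₊ : ℝ) := (Real.rpow_natCast _ _).symm
    _ ≤ (2 * x) ^ (2 * x) := Real.rpow_le_rpow_of_exponent_le (by linarith) hc'

theorem norm_riemannZeta_le_of_two_le_re {s : ℂ} (hs : 2 ≤ s.re) :
    ‖riemannZeta s‖ ≤ ∑' n : ℕ, 1 / (n : ℝ) ^ 2 := by
  rw [zeta_eq_tsum_one_div_nat_cpow (by linarith)]
  refine tsum_of_norm_bounded (Real.summable_one_div_nat_pow.2 one_lt_two).hasSum fun n ↦ ?_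
  rcases n.eq_zero_or_pos with rfl | hn
  · have : s ≠ 0 := fun h ↦ by simp [h] at hs; linarith
    simp [this]
  rw [norm_div, norm_one, norm_natCast_cpow_of_pos hn, ← Real.rpow_two]
  gcongr
  exact_mod_cast hn

open Real in
theorem norm_completedRiemannZeta₀_le_of_four_le_re :
    ∃ C : ℝ, 0 ≤ C ∧ ∀ s : ℂ, 4 ≤ s.re →
      ‖completedRiemannZeta₀ s‖ ≤ C * ‖s‖ ^ ‖s‖ := by
  set Z : ℝ := ∑' n : ℕ, 1 / (n : ℝ) ^ 2 with hZ
  have hZ0 : 0 ≤ Z := tsum_nonneg fun n ↦ by positivity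
  refine ⟨Z + 2, by linarith, fun s hs ↦ ?_⟩
  have hn : 4 ≤ ‖s‖ := hs.trans (re_le_norm s)
  have hs0 : s ≠ 0 := fun h ↦ by simp [h] at hs; linarith
  have hG : Gammaℝ s ≠ 0 := Gammaℝ_ne_zero_of_re_pos (by linarith)
  have h1 : completedRiemannZeta₀ s = Gammaℝ s * riemannZeta s + 1 / s + 1 / (1 - s) := by
    rw [riemannZeta_def_of_ne_zero hs0, mul_div_cancel₀ _ hG, completedRiemannZeta_eq]
    ring
  have hpow : 1 ≤ ‖s‖ ^ ‖s‖ := Real.one_le_rpow (by linarith) (by linarith)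
  have hGb : ‖Gammaℝ s‖ ≤ ‖s‖ ^ ‖s‖ := by
    rw [Gammaℝ_def, norm_mul, norm_cpow_eq_rpow_re_of_pos Real.pi_pos]
    have h2 : π ^ (-s / 2).re ≤ 1 := by
      refine Real.rpow_le_one_of_one_le_of_nonpos (by linarith [Real.pi_gt_three]) ?_
      simp
      linarith
    have h3 : ‖Complex.Gamma (s / 2)‖ ≤ ‖s‖ ^ ‖s‖ := by
      have hre : (s / 2).re = s.re / 2 := by simp
      refine (norm_Gamma_le_Gamma_re (by rw [hre]; linarith)).trans ?_
      rw [hre]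
      refine (Gamma_real_le_rpow (by linarith)).trans ?_
      rw [mul_div_cancel₀ _ two_ne_zero]
      calc s.re ^ s.re ≤ ‖s‖ ^ s.re := by gcongr; exact re_le_norm s
        _ ≤ _ := Real.rpow_le_rpow_of_exponent_le (by linarith) (re_le_norm s)
    calc _ ≤ 1 * ‖s‖ ^ ‖s‖ := by gcongr
      _ = _ := one_mul _
  have hs1 : ‖1 / s‖ ≤ 1 := by
    rw [norm_div, norm_one]
    exact div_le_one_of_le₀ (by linarith) (by linarith)
  have hs2 : ‖1 / (1 - s)‖ ≤ 1 := by
    rw [norm_div, norm_one]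
    refine div_le_one_of_le₀ ?_ (norm_nonneg _)
    have := norm_sub_norm_le s 1
    rw [norm_one, norm_sub_rev] at this
    linarith
  rw [h1]
  calc _ ≤ ‖Gammaℝ s‖ * ‖riemannZeta s‖ + ‖1 / s‖ + ‖1 / (1 - s)‖ := by
        rw [← norm_mul]; exact norm_add₃_le
    _ ≤ ‖s‖ ^ ‖s‖ * Z + 1 + 1 := by
        gcongr
        exact norm_riemannZeta_le_of_two_le_re (by linarith)
    _ ≤ _ := by linarith

/-- `s * (1 - s) * completedRiemannZeta s`, with its removable singularities filled in. -/
def xiFunction (s : ℂ) : ℂ := s * (1 - s) * completedRiemannZeta₀ s - 1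

theorem differentiable_xiFunction : Differentiable ℂ xiFunction := by
  have := differentiable_completedZeta₀
  unfold xiFunction
  fun_prop

theorem xiFunction_one_sub (s : ℂ) : xiFunction (1 - s) = xiFunction s := by
  rw [xiFunction, xiFunction, completedRiemannZeta₀_one_sub]
  ring

theorem xiFunction_eq_zero {s : ℂ} (hs : riemannZeta s = 0) (h0 : 0 < s.re) (h1 : s.re < 1) :
    xiFunction s = 0 := by
  have hs0 : s ≠ 0 := fun h ↦ by simp [h] at h0
  have hs1 : 1 - s ≠ 0 := fun h ↦ by simp [← sub_eq_zero.1 h] at h1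
  have hG : Gammaℝ s ≠ 0 := Gammaℝ_ne_zero_of_re_pos h0
  rw [riemannZeta_def_of_ne_zero hs0, div_eq_zero_iff, or_iff_left hG,
    completedRiemannZeta_eq] at hs
  field_simp at hs
  rw [xiFunction]
  linear_combination hs

/-- `ξ` has order at most `6 / 5` (in fact order one). -/
theorem norm_xiFunction_le :
    ∃ C : ℝ, 0 ≤ C ∧ ∀ R : ℝ, 1 ≤ R → ∀ s : ℂ, ‖s‖ ≤ R →
      ‖xiFunction s‖ ≤ Real.exp (C * R ^ (6 / 5 : ℝ)) := by
  obtain ⟨A, hA⟩ := norm_completedRiemannZeta₀_le_of_re_mem_Icc 0 4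
  obtain ⟨B, hB, hB'⟩ := norm_completedRiemannZeta₀_le_of_four_le_re
  have hA0 : 0 ≤ A := (norm_nonneg _).trans (hA 0 le_rfl (by norm_num))
  set D := A + B + 1 with hD
  have key (T : ℝ) (hT : 2 ≤ T) (s : ℂ) (hs : ‖s‖ ≤ T) (hre : 0 ≤ s.re) :
      ‖xiFunction s‖ ≤ Real.exp (D + 4 * T * Real.log T) := by
    have hpow : 1 ≤ T ^ T := Real.one_le_rpow (by linarith) (by linarith)
    have hΛ : ‖completedRiemannZeta₀ s‖ ≤ (A + B) * T ^ T := by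
      rcases le_total s.re 4 with h | h
      · nlinarith [hA s hre h]
      · refine (hB' s h).trans ?_
        have hn : 4 ≤ ‖s‖ := h.trans (re_le_norm s)
        have : ‖s‖ ^ ‖s‖ ≤ T ^ T :=
          (Real.rpow_le_rpow (norm_nonneg _) hs (norm_nonneg _)).trans
            (Real.rpow_le_rpow_of_exponent_le (by linarith) hs)
        calc B * ‖s‖ ^ ‖s‖ ≤ B * T ^ T := by gcongr
          _ ≤ _ := by nlinarith
    have h1s : ‖1 - s‖ ≤ 1 + T := (norm_sub_le _ _).trans (by rw [norm_one]; linarith)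
    have hT3 : T * (1 + T) ≤ T ^ 3 := by
      nlinarith [mul_nonneg (by linarith : 0 ≤ T) (by linarith : 0 ≤ T - 2)]
    have hT3' : T ^ 3 ≤ Real.exp (3 * T * Real.log T) := by
      have hlog : 0 ≤ Real.log T := Real.log_nonneg (by linarith)
      rw [show (3 : ℝ) * T * Real.log T = (3 : ℕ) * (Real.log T * T) by push_cast; ring,
        Real.exp_nat_mul]
      have : T ≤ Real.exp (Real.log T * T) := by
        calc T = Real.exp (Real.log T * 1) := by rw [mul_one, Real.exp_log (by linarith)]
          _ ≤ _ := by gcongr; linarith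
      gcongr
    have hTT : T ^ T = Real.exp (T * Real.log T) := by
      rw [Real.rpow_def_of_pos (by linarith), mul_comm]
    have hDe : D ≤ Real.exp D := (by linarith : D ≤ D + 1).trans (Real.add_one_le_exp D)
    calc ‖xiFunction s‖ ≤ ‖s‖ * ‖1 - s‖ * ‖completedRiemannZeta₀ s‖ + 1 := by
          rw [xiFunction]
          refine (norm_sub_le _ _).trans ?_
          rw [norm_mul, norm_mul, norm_one]
      _ ≤ T * (1 + T) * ((A + B) * T ^ T) + 1 := by gcongr
      _ ≤ T ^ 3 * (D * T ^ T) := by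
          have h3 : 1 ≤ T ^ 3 := one_le_pow₀ (by linarith)
          have h4 : T * (1 + T) * ((A + B) * T ^ T) ≤ T ^ 3 * ((A + B) * T ^ T) := by gcongr
          have h5 : 1 ≤ T ^ 3 * T ^ T := one_le_mul_of_one_le_of_one_le h3 hpow
          rw [hD]
          linarith
      _ ≤ Real.exp (3 * T * Real.log T) * (Real.exp D * Real.exp (T * Real.log T)) := by
          rw [hTT]
          gcongr
      _ = _ := by
          rw [← Real.exp_add, ← Real.exp_add]
          congr 1
          ring
  refine ⟨D + 80, by linarith, fun R hR s hs ↦ ?_⟩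
  have hR0 : 0 ≤ R := by linarith
  have h2R : ‖xiFunction s‖ ≤ Real.exp (D + 4 * (2 * R) * Real.log (2 * R)) := by
    rcases le_total 0 s.re with h | h
    · exact key (2 * R) (by linarith) s (by linarith) h
    · rw [← xiFunction_one_sub]
      refine key (2 * R) (by linarith) _ ((norm_sub_le _ _).trans ?_) (by simp; linarith)
      rw [norm_one]
      linarith
  refine h2R.trans (Real.exp_le_exp.2 ?_)
  have hlog : Real.log (2 * R) ≤ 10 * R ^ (1 / 5 : ℝ) := by
    have h := Real.log_le_rpow_div (show 0 ≤ 2 * R by linarith) (show (0 : ℝ) < 1 / 5 by norm_num)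
    rw [Real.mul_rpow two_pos.le hR0] at h
    have h2 : (2 : ℝ) ^ (1 / 5 : ℝ) ≤ 2 := by
      calc (2 : ℝ) ^ (1 / 5 : ℝ) ≤ 2 ^ (1 : ℝ) :=
            Real.rpow_le_rpow_of_exponent_le one_le_two (by norm_num)
        _ = 2 := Real.rpow_one 2
    have : 0 ≤ R ^ (1 / 5 : ℝ) := by positivity
    nlinarith
  have hsplit : R ^ (6 / 5 : ℝ) = R * R ^ (1 / 5 : ℝ) := by
    rw [show (6 / 5 : ℝ) = 1 + 1 / 5 by norm_num, Real.rpow_add (by linarith), Real.rpow_one]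
  have h1 : 1 ≤ R ^ (6 / 5 : ℝ) := Real.one_le_rpow hR (by norm_num)
  have h2 : 4 * (2 * R) * Real.log (2 * R) ≤ 80 * R ^ (6 / 5 : ℝ) := by
    rw [hsplit]
    calc 4 * (2 * R) * Real.log (2 * R) ≤ 4 * (2 * R) * (10 * R ^ (1 / 5 : ℝ)) := by gcongr
      _ = _ := by ring
  nlinarith

theorem summable_zetaZeros_rpow_neg :
    Summable fun ρ : zetaZeros ↦ ‖(ρ : ℂ) / 2 + 1‖ ^ (-(5 / 4) : ℝ) := by
  obtain ⟨C, hC, hbound⟩ := norm_xiFunction_le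
  refine summable_rpow_neg_of_card_le (C := C * (Real.exp 1 * 4) ^ (6 / 5 : ℝ)) (a := 6 / 5)
    (fun ρ ↦ ?_) (by norm_num) (by norm_num) fun r hr S hS ↦ ?_
  · have h := re_le_norm ((ρ : ℂ) / 2 + 1)
    have hre : ((ρ : ℂ) / 2 + 1).re = (ρ : ℂ).re / 2 + 1 := by simp
    linarith [ρ.2.2.1]
  · have hR : 1 ≤ Real.exp 1 * (4 * r) := by nlinarith [Real.add_one_lt_exp one_ne_zero]
    have h := card_zeros_le_log differentiable_xiFunction (r := 4 * r)
      (M := Real.exp (C * (Real.exp 1 * (4 * r)) ^ (6 / 5 : ℝ))) (by simp [xiFunction])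
      (by linarith) (Real.one_le_exp (by positivity)) (fun z hz ↦ hbound _ hR z hz.le)
      (S.map (Function.Embedding.subtype _)) fun z hz ↦ ?_
    · rw [Finset.card_map, Real.log_exp, ← mul_assoc (Real.exp 1),
        Real.mul_rpow (by positivity) (by positivity), ← mul_assoc] at h
      exact h
    · obtain ⟨ρ, hρS, rfl⟩ := Finset.mem_map.1 hz
      refine ⟨?_, xiFunction_eq_zero ρ.2.1 ρ.2.2.1 ρ.2.2.2⟩
      have h1 := norm_sub_le ((ρ : ℂ) / 2 + 1) 1
      rw [add_sub_cancel_right, norm_div, norm_ofNat, norm_one] at h1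
      simp only [Function.Embedding.subtype_apply]
      linarith [hS ρ hρS]

theorem countable_zetaZeros : Countable zetaZeros := by
  refine Set.countable_univ_iff.1
    (summable_zetaZeros_rpow_neg.countable_support.mono fun ρ _ ↦ ?_)
  have h0 : (ρ : ℂ) / 2 + 1 ≠ 0 := fun h ↦ by
    have h := congrArg re h
    simp at h
    linarith [ρ.2.2.1]
  exact (Real.rpow_pos_of_pos (norm_pos_iff.2 h0) _).ne'

open Filter Topology in
theorem exists_pos_le_norm_of_mem_zetaZeros : ∃ δ : ℝ, 0 < δ ∧ ∀ ρ ∈ zetaZeros, δ ≤ ‖ρ‖ := by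
  have h0 : xiFunction 0 ≠ 0 := by simp [xiFunction]
  obtain ⟨δ, hδ, h⟩ := Metric.eventually_nhds_iff.1
    (differentiable_xiFunction.continuous.continuousAt.eventually_ne h0)
  refine ⟨δ, hδ, fun ρ hρ ↦ ?_⟩
  by_contra! hlt
  exact h (by simpa using hlt) (xiFunction_eq_zero hρ.1 hρ.2.1 hρ.2.2)

theorem rpow_mul_exp_neg_mul_le {c x p : ℝ} (hc : 0 < c) (hx : 0 ≤ x) (hp : 0 ≤ p) (hp2 : p ≤ 2) :
    x ^ p * Real.exp (-(c * x)) ≤ 1 + 2 / c ^ 2 := by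
  have h1 : x ^ p ≤ 1 + x ^ 2 := by
    rcases le_total x 1 with h | h
    · exact (Real.rpow_le_one hx h hp).trans (by nlinarith)
    · calc x ^ p ≤ x ^ (2 : ℝ) := Real.rpow_le_rpow_of_exponent_le h hp2
        _ ≤ _ := by rw [Real.rpow_two]; linarith
  have h2 := Real.quadratic_le_exp_of_nonneg (mul_nonneg hc.le hx)
  rw [Real.exp_neg, ← div_eq_mul_inv, div_le_iff₀ (Real.exp_pos _)]
  have h3 : 0 ≤ c * x := by positivity
  have h4 : x ^ 2 ≤ 2 / c ^ 2 * Real.exp (c * x) := by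
    rw [div_mul_eq_mul_div, le_div_iff₀ (by positivity)]
    nlinarith
  have h5 : 1 ≤ Real.exp (c * x) := Real.one_le_exp h3
  nlinarith

/-- On a vertical line, the summands of the series over zeros decay like `‖ρ‖ ^ (-5 / 4)`, up to a
power of `‖z‖`. -/
theorem norm_cpow_mul_Gamma_le {c : ℝ} (hc : 0 < c) :
    ∃ K : ℝ, 0 ≤ K ∧ ∀ ρ ∈ zetaZeros, ∀ z : ℂ, z.re = c →
      ‖z ^ (-ρ / 2) * Complex.Gamma (ρ / 2)‖ ≤
        K * ‖ρ / 2 + 1‖ ^ (-(5 / 4) : ℝ) * ‖z‖ ^ (3 / 4 : ℝ) := by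
  obtain ⟨δ, hδ, hδ'⟩ := exists_pos_le_norm_of_mem_zetaZeros
  set A := 5 * Real.exp (3 / 2) with hA
  set B := 1 + 2 / δ with hB
  set E := 1 + 2 / c ^ 2 with hE
  refine ⟨A * B * Real.exp 2 * E, by positivity, fun ρ hρ z hz ↦ ?_⟩
  set s := ρ / 2 with hs
  have hσ : s.re = ρ.re / 2 := by simp [hs]
  have hσ0 : 0 < s.re := by linarith [hρ.2.1]
  have hσ1 : s.re < 1 / 2 := by linarith [hρ.2.2]
  have hs0 : s ≠ 0 := fun h ↦ by simp [h] at hσ0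
  have hz0 : z ≠ 0 := fun h ↦ by simp [h] at hz; linarith
  have hzn : 0 < ‖z‖ := norm_pos_iff.2 hz0
  have hcz : c ≤ ‖z‖ := hz ▸ re_le_norm z
  set r := ‖s + 1‖ with hr
  have hr1 : 1 ≤ r := by
    have := re_le_norm (s + 1)
    simp only [add_re, one_re] at this
    linarith
  have hrt : r - 2 ≤ |s.im| := by
    have := norm_le_abs_re_add_abs_im (s + 1)
    simp only [add_re, one_re, add_im, one_im, add_zero] at this
    rw [abs_of_pos (by linarith)] at this
    linarith
  have hinv : ‖s‖⁻¹ ≤ B * r⁻¹ := by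
    have hsn : 0 < ‖s‖ := norm_pos_iff.2 hs0
    have hsδ : δ ≤ 2 * ‖s‖ := by
      have := hδ' ρ hρ
      rw [hs, norm_div, norm_ofNat]
      linarith
    have h1 : r ≤ B * ‖s‖ := by
      have h2 : r ≤ ‖s‖ + 1 := by simpa using norm_add_le s 1
      have h3 : 1 ≤ 2 / δ * ‖s‖ := by
        rw [div_mul_eq_mul_div, le_div_iff₀ hδ]
        linarith
      rw [hB]
      linarith
    rw [← div_eq_mul_inv, inv_le_comm₀ hsn (by positivity), inv_div, div_le_iff₀ (by positivity)]
    linarith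
  have hGamma : ‖Complex.Gamma s‖ ≤
      A * r ^ (s.re + 1 / 2) * Real.exp (-(Real.pi / 2 * |s.im|)) * (B * r⁻¹) := by
    have h1 : Complex.Gamma s = Complex.Gamma (s + 1) * s⁻¹ := by
      rw [Complex.Gamma_add_one s hs0]
      field_simp
    rw [h1, norm_mul, norm_inv]
    gcongr
    exact norm_Gamma_add_one_le hσ0.le hσ1.le
  have hcpow : ‖z ^ (-ρ / 2)‖ ≤ ‖z‖ ^ (-s.re) * Real.exp (|s.im| * |z.arg|) := by
    rw [neg_div, ← hs, norm_cpow_of_ne_zero hz0, neg_re, neg_im, div_eq_mul_inv, ← Real.exp_neg]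
    gcongr
    rw [mul_neg, neg_neg, mul_comm]
    exact (le_abs_self _).trans (abs_mul _ _).le
  have hexp : Real.exp (|s.im| * |z.arg|) * Real.exp (-(Real.pi / 2 * |s.im|)) ≤
      Real.exp 2 * Real.exp (-(c * (r / ‖z‖))) := by
    rw [← Real.exp_add, ← Real.exp_add, Real.exp_le_exp]
    have h1 := re_div_norm_le_pi_div_two_sub_abs_arg (z := z) (by linarith)
    rw [hz] at h1
    have h2 : c / ‖z‖ ≤ 1 := div_le_one_of_le₀ hcz hzn.le
    have h3 : 0 ≤ c / ‖z‖ := by positivity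
    have h4 : |s.im| * (c / ‖z‖) ≤ |s.im| * (Real.pi / 2 - |z.arg|) := by gcongr
    have h5 : (r - 2) * (c / ‖z‖) ≤ |s.im| * (c / ‖z‖) := by gcongr
    have h6 : c * (r / ‖z‖) = r * (c / ‖z‖) := by ring
    rw [h6]
    nlinarith
  have hrpow : ‖z‖ ^ (-s.re) * r ^ (s.re + 1 / 2) * r⁻¹ =
      r ^ (-(5 / 4) : ℝ) * ‖z‖ ^ (3 / 4 : ℝ) * (r / ‖z‖) ^ (s.re + 3 / 4) := by
    have hr0 : 0 < r := by linarith
    rw [Real.div_rpow hr0.le hzn.le, mul_assoc, ← Real.rpow_neg_one r, ← Real.rpow_add hr0,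
      div_eq_mul_inv (r ^ _), ← Real.rpow_neg hzn.le, mul_mul_mul_comm, ← Real.rpow_add hr0,
      ← Real.rpow_add hzn, mul_comm]
    congr 2 <;> ring
  have hfin := rpow_mul_exp_neg_mul_le (x := r / ‖z‖) (p := s.re + 3 / 4) hc (by positivity)
    (by linarith) (by linarith)
  rw [norm_mul]
  calc ‖z ^ (-ρ / 2)‖ * ‖Complex.Gamma s‖ ≤ (‖z‖ ^ (-s.re) * Real.exp (|s.im| * |z.arg|)) *
        (A * r ^ (s.re + 1 / 2) * Real.exp (-(Real.pi / 2 * |s.im|)) * (B * r⁻¹)) := by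
        gcongr
    _ = A * B * (‖z‖ ^ (-s.re) * r ^ (s.re + 1 / 2) * r⁻¹) *
        (Real.exp (|s.im| * |z.arg|) * Real.exp (-(Real.pi / 2 * |s.im|))) := by ring
    _ ≤ A * B * (r ^ (-(5 / 4) : ℝ) * ‖z‖ ^ (3 / 4 : ℝ) * (r / ‖z‖) ^ (s.re + 3 / 4)) *
        (Real.exp 2 * Real.exp (-(c * (r / ‖z‖)))) := by
        rw [hrpow]
        gcongr
    _ = A * B * Real.exp 2 * r ^ (-(5 / 4) : ℝ) * ‖z‖ ^ (3 / 4 : ℝ) *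
        ((r / ‖z‖) ^ (s.re + 3 / 4) * Real.exp (-(c * (r / ‖z‖)))) := by ring
    _ ≤ A * B * Real.exp 2 * r ^ (-(5 / 4) : ℝ) * ‖z‖ ^ (3 / 4 : ℝ) * E := by gcongr
    _ = _ := by ring

/-- The summand of the double series over zeros, on the line `Re z = c`. -/
def doubleZeroTerm (x k : ℝ) (c : ℝ) (p : zetaZeros × zetaZeros) (y : ℝ) : ℂ :=
  cexp (x * (c + y * I)) * ((c : ℂ) + y * I) ^ (-(k : ℂ) - 2) *
    (((c : ℂ) + y * I) ^ (-(p.1 : ℂ) / 2) * Complex.Gamma ((p.1 : ℂ) / 2)) *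
      (((c : ℂ) + y * I) ^ (-(p.2 : ℂ) / 2) * Complex.Gamma ((p.2 : ℂ) / 2))

theorem continuous_vertical_cpow {c : ℝ} (hc : 0 < c) (w : ℂ) :
    Continuous fun y : ℝ ↦ ((c : ℂ) + y * I) ^ w :=
  Continuous.cpow (by fun_prop) continuous_const fun y ↦ Or.inl (by simpa using hc)

theorem norm_doubleZeroTerm_le {x k c : ℝ} (hc : 0 < c) :
    ∃ K : ℝ, ∀ p y, ‖doubleZeroTerm x k c p y‖ ≤
      K * (‖(p.1 : ℂ) / 2 + 1‖ ^ (-(5 / 4) : ℝ) * ‖(p.2 : ℂ) / 2 + 1‖ ^ (-(5 / 4) : ℝ)) *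
        ‖(c : ℂ) + y * I‖ ^ (-(k + 1 / 2)) := by
  obtain ⟨K, hK, hbound⟩ := norm_cpow_mul_Gamma_le hc
  refine ⟨Real.exp (x * c) * K ^ 2, fun p y ↦ ?_⟩
  have hre : ((c : ℂ) + y * I).re = c := by simp
  have h0 : (c : ℂ) + y * I ≠ 0 := fun h ↦ hc.ne' (by simpa using congrArg re h)
  have hn : 0 < ‖(c : ℂ) + y * I‖ := norm_pos_iff.2 h0
  have hexp : ‖cexp (x * (c + y * I))‖ = Real.exp (x * c) := by
    rw [norm_exp]
    simp
  have hpow : ‖((c : ℂ) + y * I) ^ (-(k : ℂ) - 2)‖ = ‖(c : ℂ) + y * I‖ ^ (-k - 2) := by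
    rw [norm_cpow_of_ne_zero h0]
    simp
  rw [doubleZeroTerm, norm_mul, norm_mul, norm_mul (cexp _), hexp, hpow]
  calc _ ≤ Real.exp (x * c) * ‖(c : ℂ) + y * I‖ ^ (-k - 2) *
        (K * ‖(p.1 : ℂ) / 2 + 1‖ ^ (-(5 / 4) : ℝ) * ‖(c : ℂ) + y * I‖ ^ (3 / 4 : ℝ)) *
        (K * ‖(p.2 : ℂ) / 2 + 1‖ ^ (-(5 / 4) : ℝ) * ‖(c : ℂ) + y * I‖ ^ (3 / 4 : ℝ)) := by
        gcongr
        · exact hbound _ p.1.2 _ hre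
        · exact hbound _ p.2.2 _ hre
    _ = _ := by
        rw [show -(k + 1 / 2) = (-k - 2) + 3 / 4 + 3 / 4 by ring, Real.rpow_add hn,
          Real.rpow_add hn]
        ring

open MeasureTheory in
theorem integrable_doubleZeroTerm {x k c : ℝ} (hc : 0 < c) (hk : 1 / 2 < k)
    (p : zetaZeros × zetaZeros) : Integrable (doubleZeroTerm x k c p) := by
  obtain ⟨K, hK⟩ := norm_doubleZeroTerm_le (x := x) (k := k) hc
  refine ((integrable_norm_vertical_rpow_neg hc (by linarith)).const_mul _).mono'
    (Continuous.aestronglyMeasurable ?_) (ae_of_all _ (hK p))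
  have := continuous_vertical_cpow hc
  unfold doubleZeroTerm
  fun_prop

open MeasureTheory in
theorem summable_integral_norm_doubleZeroTerm {x k c : ℝ} (hc : 0 < c) (hk : 1 / 2 < k) :
    Summable fun p ↦ ∫ y : ℝ, ‖doubleZeroTerm x k c p y‖ := by
  obtain ⟨K, hK⟩ := norm_doubleZeroTerm_le (x := x) (k := k) hc
  have hs := summable_zetaZeros_rpow_neg.mul_of_nonneg summable_zetaZeros_rpow_neg
    (fun _ ↦ by positivity) (fun _ ↦ by positivity)
  refine Summable.of_nonneg_of_le (fun p ↦ integral_nonneg fun y ↦ norm_nonneg _) (fun p ↦ ?_)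
    ((hs.mul_left K).mul_right (∫ y : ℝ, ‖(c : ℂ) + y * I‖ ^ (-(k + 1 / 2))))
  rw [← integral_const_mul]
  exact integral_mono (integrable_doubleZeroTerm hc hk p).norm
    ((integrable_norm_vertical_rpow_neg hc (by linarith)).const_mul _) (hK p)

theorem integral_doubleZeroTerm {x k c : ℝ} (hc : 0 < c) (hx : 0 < x) (hk : 1 / 2 < k)
    (p : zetaZeros × zetaZeros) :
    ∫ y : ℝ, doubleZeroTerm x k c p y = 2 * Real.pi * (x : ℂ) ^ ((k : ℂ) + 1) *
      ((x : ℂ) ^ ((p.1 : ℂ) / 2 + (p.2 : ℂ) / 2) * Complex.Gamma ((p.1 : ℂ) / 2) *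
        Complex.Gamma ((p.2 : ℂ) / 2) /
          Complex.Gamma ((k : ℂ) + 2 + (p.1 : ℂ) / 2 + (p.2 : ℂ) / 2)) := by
  have hw : 1 < ((k : ℂ) + 2 + (p.1 : ℂ) / 2 + (p.2 : ℂ) / 2).re := by
    simp
    linarith [p.1.2.2.1, p.2.2.2.1]
  have hterm (y : ℝ) : doubleZeroTerm x k c p y =
      (Complex.Gamma ((p.1 : ℂ) / 2) * Complex.Gamma ((p.2 : ℂ) / 2)) *
        (cexp (x * (c + y * I)) *
          ((c : ℂ) + y * I) ^ (-((k : ℂ) + 2 + (p.1 : ℂ) / 2 + (p.2 : ℂ) / 2))) := by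
    have h0 : (c : ℂ) + y * I ≠ 0 := fun h ↦ hc.ne' (by simpa using congrArg re h)
    rw [show -((k : ℂ) + 2 + (p.1 : ℂ) / 2 + (p.2 : ℂ) / 2) =
      (-(k : ℂ) - 2) + -(p.1 : ℂ) / 2 + -(p.2 : ℂ) / 2 by ring, cpow_add _ _ h0, cpow_add _ _ h0,
      doubleZeroTerm]
    ring
  simp_rw [hterm]
  rw [MeasureTheory.integral_const_mul, integral_exp_mul_vertical_cpow hc hx hw,
    show (k : ℂ) + 2 + (p.1 : ℂ) / 2 + (p.2 : ℂ) / 2 - 1 =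
      ((k : ℂ) + 1) + ((p.1 : ℂ) / 2 + (p.2 : ℂ) / 2) by ring,
    cpow_add _ _ (ofReal_ne_zero.2 hx.ne')]
  ring

theorem tsum_doubleZeroTerm {x k c : ℝ} (hc : 0 < c) (y : ℝ) :
    ∑' p, doubleZeroTerm x k c p y =
      cexp (x * (c + y * I)) * ((c : ℂ) + y * I) ^ (-(k : ℂ) - 2) *
        (∑' ρ : zetaZeros, ((c : ℂ) + y * I) ^ (-(ρ : ℂ) / 2) * Complex.Gamma ((ρ : ℂ) / 2)) *
          (∑' ρ : zetaZeros, ((c : ℂ) + y * I) ^ (-(ρ : ℂ) / 2) * Complex.Gamma ((ρ : ℂ) / 2)) := by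
  have hsum : Summable fun ρ : zetaZeros ↦
      ‖((c : ℂ) + y * I) ^ (-(ρ : ℂ) / 2) * Complex.Gamma ((ρ : ℂ) / 2)‖ := by
    obtain ⟨K, -, hK⟩ := norm_cpow_mul_Gamma_le hc
    exact Summable.of_nonneg_of_le (fun _ ↦ norm_nonneg _) (fun ρ ↦ hK ρ ρ.2 _ (by simp))
      ((summable_zetaZeros_rpow_neg.mul_left K).mul_right _)
  rw [mul_assoc, tsum_mul_tsum_of_summable_norm hsum hsum, ← tsum_mul_left]
  simp_rw [doubleZeroTerm, mul_assoc]

/-- Evaluation of `I₅`: the double series over zeros can be exchanged with the integral, and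
`(1/(8π i)) ∫_{(1/N)} e^{Nz} z^{-k-2} (∑_{ρ₁} z^{-ρ₁/2} Γ(ρ₁/2)) (∑_{ρ₂} z^{-ρ₂/2} Γ(ρ₂/2)) dz
  = (N^{k+1}/4) ∑_{ρ₁}∑_{ρ₂} N^{ρ₁/2+ρ₂/2} Γ(ρ₁/2)Γ(ρ₂/2)/Γ(k+2+ρ₁/2+ρ₂/2)`. -/
theorem I5_evaluation (N : ℕ) (hN : 1 < N) (k : ℝ) (hk : 1 / 2 < k) :
    Summable (fun p : zetaZeros × zetaZeros =>
      ∫ y : ℝ,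
        ‖Complex.exp ((N : ℂ) * ((1 / (N : ℂ)) + y * Complex.I)) *
            ((1 / (N : ℂ)) + y * Complex.I) ^ (-(k : ℂ) - 2) *
              (((1 / (N : ℂ)) + y * Complex.I) ^ (-(p.1 : ℂ) / 2) *
                Complex.Gamma ((p.1 : ℂ) / 2)) *
                (((1 / (N : ℂ)) + y * Complex.I) ^ (-(p.2 : ℂ) / 2) *
                  Complex.Gamma ((p.2 : ℂ) / 2))‖) ∧
    (1 / (8 * (Real.pi : ℂ) * Complex.I)) *
        (∫ y : ℝ,
          Complex.exp ((N : ℂ) * ((1 / (N : ℂ)) + y * Complex.I)) *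
            ((1 / (N : ℂ)) + y * Complex.I) ^ (-(k : ℂ) - 2) *
              (∑' ρ : zetaZeros,
                ((1 / (N : ℂ)) + y * Complex.I) ^ (-(ρ : ℂ) / 2) *
                  Complex.Gamma ((ρ : ℂ) / 2)) *
                (∑' ρ : zetaZeros,
                  ((1 / (N : ℂ)) + y * Complex.I) ^ (-(ρ : ℂ) / 2) *
                    Complex.Gamma ((ρ : ℂ) / 2)) *
                Complex.I)
      = (N : ℂ) ^ ((k : ℂ) + 1) / 4 *
          ∑' p : zetaZeros × zetaZeros,
            (N : ℂ) ^ ((p.1 : ℂ) / 2 + (p.2 : ℂ) / 2) * Complex.Gamma ((p.1 : ℂ) / 2) *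
              Complex.Gamma ((p.2 : ℂ) / 2) /
                Complex.Gamma ((k : ℂ) + 2 + (p.1 : ℂ) / 2 + (p.2 : ℂ) / 2) := by
  have hN0 : (0 : ℝ) < N := by exact_mod_cast zero_lt_one.trans hN
  have hc : (0 : ℝ) < 1 / N := by positivity
  have := countable_zetaZeros
  have hcast : (1 / (N : ℂ)) = ((1 / N : ℝ) : ℂ) := by push_cast; rfl
  have hcastN : (N : ℂ) = ((N : ℝ) : ℂ) := by push_cast; rfl
  have hsum := summable_integral_norm_doubleZeroTerm (x := N) hc hk
  simp_rw [hcast, hcastN]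
  refine ⟨hsum, ?_⟩
  rw [MeasureTheory.integral_mul_const]
  simp_rw [← tsum_doubleZeroTerm hc]
  rw [← (MeasureTheory.hasSum_integral_of_summable_integral_norm
    (integrable_doubleZeroTerm hc hk) hsum).tsum_eq]
  simp_rw [integral_doubleZeroTerm hc hN0 hk]
  rw [tsum_mul_left]
  have hpi : (Real.pi : ℂ) ≠ 0 := ofReal_ne_zero.2 Real.pi_ne_zero
  field_simp [I_ne_zero]
  ring

end
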